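/- (Navon) For every Dyck word w with n x's and every integer k, the normal order coefficient S_w(k) equals r_{n−k}(B_w), the number of placements of n−k non-attacking rooks on the Ferrers board B_w. -/

import Mathlib

/-- A word in the symbols `x` (here `true`) and `D` (here `false`) is a Dyck word if it has
equally many `x`'s and `D`'s and every prefix has at least as many `x`'s as `D`'s. -/
def IsDyck (w : List Bool) : Prop :=
  w.count true = w.count false ∧
    ∀ p : ℕ, (w.take p).count false ≤ (w.take p).count true

/-- The operator of multiplication by `X` on `ℝ[X]`. -/
noncomputable def xOp : Polynomial ℝ →ₗ[ℝ] Polynomial ℝ := LinearMap.mulLeft ℝ Polynomial.X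

/-- The derivative operator on `ℝ[X]`. -/
noncomputable def dOp : Polynomial ℝ →ₗ[ℝ] Polynomial ℝ := Polynomial.derivative

/-- The operator on `ℝ[X]` represented by a word in `x` and `D`, read left to right (so the
leftmost symbol is the outermost operator). -/
noncomputable def wordOp : List Bool → (Polynomial ℝ →ₗ[ℝ] Polynomial ℝ)
  | [] => LinearMap.id
  | b :: w => (if b then xOp else dOp) ∘ₗ wordOp w

/-- The operator `x^k D^k` on `ℝ[X]` (interpreted as `0` for negative `k`). -/
noncomputable def xkDk (k : ℤ) : Polynomial ℝ →ₗ[ℝ] Polynomial ℝ :=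
  if 0 ≤ k then (xOp ^ k.toNat) ∘ₗ (dOp ^ k.toNat) else 0

/-- `S : ℤ → ℝ` is the (finitely supported) sequence of normal order coefficients of the
word `w`, i.e. `w = Σ_k S k • x^k D^k` as operators on `ℝ[X]`, with `S k = 0` for `k < 0`. -/
def IsNormalOrder (w : List Bool) (S : ℤ → ℝ) : Prop :=
  (Function.support S).Finite ∧ (∀ k : ℤ, k < 0 → S k = 0) ∧
    wordOp w = ∑ᶠ k : ℤ, S k • xkDk k
/-- `xsBefore w i` is the number of `x`'s (`true`s) occurring before the `i`-th `D` (`false`)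
in the word `w` (1-indexed); if `w` has fewer than `i` `D`'s it is the total number of `x`'s. -/
def xsBefore : List Bool → ℕ → ℕ
  | [], _ => 0
  | _ :: _, 0 => 0
  | true :: w, i + 1 => xsBefore w (i + 1) + 1
  | false :: w, i + 1 => if i = 0 then 0 else xsBefore w i

/-- The Ferrers board `B_w`: the set of (labels of) unit squares lying above the Dyck path of
`w` and inside the box `[0,n] × [0,n]`, where the unit square with top-right corner `(i,j)` is
labelled `(i,j)`.  The square `(i,j)` lies above the path exactly when the `i`-th `D` of `w`
occurs before the `j`-th `x`, i.e. when `xsBefore w i < j`. -/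
def ferrersBoard (w : List Bool) : Finset (ℕ × ℕ) :=
  ((Finset.Icc 1 (w.count true)) ×ˢ (Finset.Icc 1 (w.count true))).filter
    (fun p => xsBefore w p.1 < p.2)

/-- `rookCount B k` is the number of placements of `k` non-attacking rooks on the board `B`:
`k`-element subsets of `B` with no two elements sharing a first coordinate and no two sharing
a second coordinate. -/
noncomputable def rookCount (B : Finset (ℕ × ℕ)) (k : ℕ) : ℕ :=
  Nat.card {s : Finset (ℕ × ℕ) // s ⊆ B ∧ s.card = k ∧
    ∀ p ∈ s, ∀ q ∈ s, p ≠ q → p.1 ≠ q.1 ∧ p.2 ≠ q.2}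

/-- The clique-union graph `H_w` on vertex set `{1, …, n}` (encoded as `Fin n`, vertex `i`
having label `i+1`): labels `i < j` are adjacent iff the unit square labelled `(i,j)` lies
below the Dyck path of `w` and completely above the line `x = y`, i.e. iff the `j`-th `x`
occurs before the `i`-th `D`, i.e. iff `j ≤ xsBefore w i`. -/
def cliqueUnionGraph (w : List Bool) : SimpleGraph (Fin (w.count true)) :=
  SimpleGraph.fromRel (fun i j => (i : ℕ) < (j : ℕ) ∧ (j : ℕ) + 1 ≤ xsBefore w ((i : ℕ) + 1))

/-- The bipartite graph `Γ_w` with partition classes `X = {x_1, …, x_n}` (the `inl` vertices)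
and `Y = {y_1, …, y_n}` (the `inr` vertices), with an edge from `x_i` to `y_j` iff
`(i,j) ∈ B_w`. -/
def bipGraph (w : List Bool) : SimpleGraph (Fin (w.count true) ⊕ Fin (w.count true)) :=
  SimpleGraph.fromRel (fun a b => ∃ i j : Fin (w.count true),
    a = Sum.inl i ∧ b = Sum.inr j ∧ xsBefore w ((i : ℕ) + 1) < (j : ℕ) + 1)

/-- `matchCount G k` is the number of matchings of size `k` in `G`: sets of `k` edges of `G`,
pairwise sharing no endvertex. -/
noncomputable def matchCount {V : Type*} (G : SimpleGraph V) (k : ℕ) : ℕ :=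
  Nat.card {s : Finset (Sym2 V) // s.card = k ∧ (∀ e ∈ s, e ∈ G.edgeSet) ∧
    ∀ e ∈ s, ∀ f ∈ s, e ≠ f → ∀ v : V, v ∈ e → v ∉ f}

/-- The matching number of `G`: the size of a largest matching. -/
noncomputable def matchNumber {V : Type*} (G : SimpleGraph V) : ℕ :=
  sSup {k : ℕ | 0 < matchCount G k}

/-- The placements of `k` non-attacking rooks on `B`, as a finset. -/
def rookPlacements (B : Finset (ℕ × ℕ)) (k : ℕ) : Finset (Finset (ℕ × ℕ)) :=
  (B.powersetCard k).filter
    (fun s => ∀ p ∈ s, ∀ q ∈ s, p ≠ q → p.1 ≠ q.1 ∧ p.2 ≠ q.2)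

theorem mem_rookPlacements {B : Finset (ℕ × ℕ)} {k : ℕ} {s : Finset (ℕ × ℕ)} :
    s ∈ rookPlacements B k ↔ s ⊆ B ∧ s.card = k ∧
      ∀ p ∈ s, ∀ q ∈ s, p ≠ q → p.1 ≠ q.1 ∧ p.2 ≠ q.2 := by
  simp only [rookPlacements, Finset.mem_filter, Finset.mem_powersetCard, and_assoc]

theorem rookCount_eq_card (B : Finset (ℕ × ℕ)) (k : ℕ) :
    rookCount B k = (rookPlacements B k).card := by
  rw [rookCount, ← Nat.card_eq_finsetCard]
  exact Nat.card_congr (Equiv.subtypeEquivRight fun _ => mem_rookPlacements.symm)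

theorem rookCount_zero (B : Finset (ℕ × ℕ)) : rookCount B 0 = 1 := by
  rw [rookCount_eq_card, Finset.card_eq_one]
  refine ⟨∅, ?_⟩
  ext s
  rw [mem_rookPlacements, Finset.mem_singleton]
  constructor
  · rintro ⟨-, h, -⟩
    exact Finset.card_eq_zero.1 h
  · rintro rfl
    simp

/-- Relabelling rows and columns injectively does not change the rook numbers. -/
theorem rookCount_map (f g : ℕ ↪ ℕ) (B : Finset (ℕ × ℕ)) (k : ℕ) :
    rookCount (B.map (f.prodMap g)) k = rookCount B k := by
  rw [rookCount_eq_card, rookCount_eq_card,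
    ← Finset.card_map (s := rookPlacements B k)
      (Finset.mapEmbedding (f.prodMap g)).toEmbedding]
  congr 1
  ext s
  simp only [Finset.mem_map, mem_rookPlacements, Finset.subset_map_iff]
  constructor
  · rintro ⟨⟨t, ht, rfl⟩, hc, h⟩
    refine ⟨t, ⟨ht, by simpa using hc, fun p hp q hq hpq => ?_⟩, rfl⟩
    have := h _ (Finset.mem_map_of_mem _ hp) _ (Finset.mem_map_of_mem _ hq)
      (fun e => hpq ((f.prodMap g).injective e))
    exact ⟨fun e => this.1 (congrArg f e), fun e => this.2 (congrArg g e)⟩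
  · rintro ⟨t, ⟨ht, hc, h⟩, rfl⟩
    refine ⟨⟨t, ht, rfl⟩, by simpa using hc, ?_⟩
    intro p hp q hq hpq
    obtain ⟨p', hp', rfl⟩ := Finset.mem_map.1 hp
    obtain ⟨q', hq', rfl⟩ := Finset.mem_map.1 hq
    have := h p' hp' q' hq' (fun e => hpq (congrArg _ e))
    exact ⟨fun e => this.1 (f.injective e), fun e => this.2 (g.injective e)⟩

theorem card_le_of_mem_rookPlacements {B : Finset (ℕ × ℕ)} {I J : Finset ℕ} {k : ℕ}
    (hB : B ⊆ I ×ˢ J) {s : Finset (ℕ × ℕ)} (hs : s ∈ rookPlacements B k) :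
    k ≤ I.card ∧ k ≤ J.card := by
  obtain ⟨hsB, rfl, h⟩ := mem_rookPlacements.1 hs
  constructor
  · refine Finset.card_le_card_of_injOn Prod.fst
      (fun p hp => (Finset.mem_product.1 (hB (hsB hp))).1) fun p hp q hq e => ?_
    by_contra hpq
    exact (h p hp q hq hpq).1 e
  · refine Finset.card_le_card_of_injOn Prod.snd
      (fun p hp => (Finset.mem_product.1 (hB (hsB hp))).2) fun p hp q hq e => ?_
    by_contra hpq
    exact (h p hp q hq hpq).2 e

theorem rookCount_eq_zero {B : Finset (ℕ × ℕ)} {I J : Finset ℕ} {k : ℕ}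
    (hB : B ⊆ I ×ˢ J) (hk : I.card < k ∨ J.card < k) : rookCount B k = 0 := by
  rw [rookCount_eq_card, Finset.card_eq_zero, Finset.eq_empty_iff_forall_notMem]
  intro s hs
  have := card_le_of_mem_rookPlacements hB hs
  omega

/-- Adding a full column to a board. -/
theorem rookCount_insert_column {B : Finset (ℕ × ℕ)} {J : Finset ℕ} {c : ℕ}
    (hJ : ∀ p ∈ B, p.2 ∈ J) (hc : ∀ p ∈ B, p.1 ≠ c) (k : ℕ) :
    rookCount (({c} ×ˢ J) ∪ B) (k + 1) =
      rookCount B (k + 1) + rookCount B k * (J.card - k) := by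
  simp only [rookCount_eq_card]
  rw [← Finset.card_filter_add_card_filter_not (s := rookPlacements _ (k + 1))
    (fun s => ∀ p ∈ s, p.1 ≠ c)]
  congr 1
  · congr 1
    ext s
    simp only [Finset.mem_filter, mem_rookPlacements]
    constructor
    · rintro ⟨⟨h1, h2⟩, h3⟩
      refine ⟨fun p hp => ?_, h2⟩
      have := h1 hp
      simp only [Finset.mem_union, Finset.mem_product, Finset.mem_singleton] at this
      exact this.resolve_left fun e => h3 p hp e.1
    · rintro ⟨h1, h2⟩
      exact ⟨⟨h1.trans Finset.subset_union_right, h2⟩, fun p hp => hc p (h1 hp)⟩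
  · have hcard : ∀ s ∈ rookPlacements B k, (J \ s.image Prod.snd).card = J.card - k := by
      intro s hs
      obtain ⟨hsB, hk, h⟩ := mem_rookPlacements.1 hs
      rw [Finset.card_sdiff_of_subset, Finset.card_image_of_injOn, hk]
      · intro p hp q hq e
        by_contra hpq
        exact (h p hp q hq hpq).2 e
      · intro j hj
        obtain ⟨p, hp, rfl⟩ := Finset.mem_image.1 hj
        exact hJ p (hsB hp)
    have hsum : (rookPlacements B k).card * (J.card - k) =
        ((rookPlacements B k).sigma fun s => J \ s.image Prod.snd).card := by
      rw [Finset.card_sigma, Finset.sum_congr rfl hcard, Finset.sum_const, smul_eq_mul]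
    rw [hsum]
    symm
    refine Finset.card_bij (fun x _ => insert (c, x.2) x.1) ?_ ?_ ?_
    · rintro ⟨s, j⟩ hx
      simp only [Finset.mem_sigma, Finset.mem_sdiff, Finset.mem_image, mem_rookPlacements] at hx
      obtain ⟨⟨hsB, hk, h⟩, hj, hjs⟩ := hx
      have hne : ∀ p ∈ s, p.1 ≠ c ∧ p.2 ≠ j := fun p hp =>
        ⟨hc p (hsB hp), fun e => hjs ⟨p, hp, e⟩⟩
      simp only [Finset.mem_filter, mem_rookPlacements]
      refine ⟨⟨?_, ?_, ?_⟩, fun h' => h' _ (Finset.mem_insert_self _ _) rfl⟩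
      · intro p hp
        rcases Finset.mem_insert.1 hp with rfl | hp
        · simp [hj]
        · exact Finset.mem_union_right _ (hsB hp)
      · rw [Finset.card_insert_of_notMem (fun hm => (hne _ hm).1 rfl), hk]
      · intro p hp q hq hpq
        rcases Finset.mem_insert.1 hp with rfl | hp <;> rcases Finset.mem_insert.1 hq with rfl | hq
        · exact absurd rfl hpq
        · exact ⟨(hne q hq).1.symm, (hne q hq).2.symm⟩
        · exact hne p hp
        · exact h p hp q hq hpq
    · rintro ⟨s, j⟩ hx ⟨s', j'⟩ hx' e
      simp only [Finset.mem_sigma, mem_rookPlacements] at hx hx' e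
      have hs : (c, j) ∉ s := fun hm => hc _ (hx.1.1 hm) rfl
      have hs' : ∀ i, (c, i) ∉ s' := fun i hm => hc _ (hx'.1.1 hm) rfl
      have hj : j = j' := by
        have hm : (c, j) ∈ insert (c, j') s' := e ▸ Finset.mem_insert_self _ _
        rcases Finset.mem_insert.1 hm with h | h
        · exact congrArg Prod.snd h
        · exact absurd h (hs' j)
      subst hj
      have : s = s' := by
        rw [← Finset.erase_insert hs, e, Finset.erase_insert (hs' j)]
      subst this
      rfl
    · intro t ht
      simp only [Finset.mem_filter, mem_rookPlacements] at ht
      obtain ⟨⟨htB, hk, h⟩, hcol⟩ := ht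
      push Not at hcol
      obtain ⟨⟨c', j⟩, hp, rfl⟩ := hcol
      have hjJ : j ∈ J := by
        have := htB hp
        simp only [Finset.mem_union, Finset.mem_product, Finset.mem_singleton] at this
        exact this.elim And.right (hJ _)
      have herase : ∀ q ∈ t.erase (c', j), q.1 ≠ c' ∧ q.2 ≠ j := fun q hq =>
        h q (Finset.mem_of_mem_erase hq) _ hp (Finset.ne_of_mem_erase hq)
      refine ⟨⟨t.erase (c', j), j⟩, ?_, Finset.insert_erase hp⟩
      simp only [Finset.mem_sigma, Finset.mem_sdiff, Finset.mem_image, mem_rookPlacements]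
      refine ⟨⟨fun q hq => ?_, ?_, fun p hp q hq => h p (Finset.mem_of_mem_erase hp) q
        (Finset.mem_of_mem_erase hq)⟩, hjJ, ?_⟩
      · have := htB (Finset.mem_of_mem_erase hq)
        simp only [Finset.mem_union, Finset.mem_product, Finset.mem_singleton] at this
        exact this.resolve_left fun e => (herase q hq).1 e.1
      · rw [Finset.card_erase_of_mem hp, hk, Nat.add_sub_cancel]
      · rintro ⟨q, hq, e⟩
        exact (herase q hq).2 e

/-- The Ferrers board of an arbitrary word, with one column for each `D` and one row for
each `x`. -/
def wordBoard (w : List Bool) : Finset (ℕ × ℕ) :=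
  ((Finset.Icc 1 (w.count false)) ×ˢ (Finset.Icc 1 (w.count true))).filter
    (fun p => xsBefore w p.1 < p.2)

theorem mem_wordBoard {w : List Bool} {i j : ℕ} :
    (i, j) ∈ wordBoard w ↔ (1 ≤ i ∧ i ≤ w.count false) ∧ (1 ≤ j ∧ j ≤ w.count true) ∧
      xsBefore w i < j := by
  simp [wordBoard, and_assoc]

theorem wordBoard_cons_true (w : List Bool) :
    wordBoard (true :: w) =
      (wordBoard w).map ((Function.Embedding.refl ℕ).prodMap (addRightEmbedding 1)) := by
  ext ⟨i, j⟩
  simp only [Finset.mem_map, Prod.exists, mem_wordBoard, Function.Embedding.coe_prodMap,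
    Prod.map_apply, Function.Embedding.refl_apply, addRightEmbedding_apply, Prod.mk.injEq]
  rcases i with _ | i
  · simp
  · simp only [xsBefore, List.count_cons_self, List.count_cons_of_ne (by decide : true ≠ false)]
    constructor
    · intro h
      exact ⟨i + 1, j - 1, by omega, rfl, by omega⟩
    · rintro ⟨i', j', h, rfl, rfl⟩
      omega

theorem wordBoard_cons_false (w : List Bool) :
    wordBoard (false :: w) = ({1} ×ˢ Finset.Icc 1 (w.count true)) ∪
      (wordBoard w).map ((addRightEmbedding 1).prodMap (Function.Embedding.refl ℕ)) := by
  ext ⟨i, j⟩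
  simp only [Finset.mem_union, Finset.mem_product, Finset.mem_singleton, Finset.mem_Icc,
    Finset.mem_map, Prod.exists, mem_wordBoard, Function.Embedding.coe_prodMap,
    Prod.map_apply, Function.Embedding.refl_apply, addRightEmbedding_apply, Prod.mk.injEq,
    List.count_cons_self, List.count_cons_of_ne (by decide : false ≠ true)]
  rcases i with _ | _ | i
  · simp
  · simp only [xsBefore]
    constructor
    · intro h
      exact Or.inl ⟨trivial, h.2.1⟩
    · rintro (h | ⟨i', j', h, h', -⟩) <;> simp <;> omega
  · simp only [xsBefore, Nat.add_eq_zero_iff, one_ne_zero, and_false, if_false]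
    constructor
    · intro h
      exact Or.inr ⟨i + 1, j, by omega, rfl, rfl⟩
    · rintro (h | ⟨i', j', h, h', rfl⟩)
      · omega
      · obtain rfl : i' = i + 1 := by omega
        omega

theorem rookCount_wordBoard_cons_true (w : List Bool) (k : ℕ) :
    rookCount (wordBoard (true :: w)) k = rookCount (wordBoard w) k := by
  rw [wordBoard_cons_true, rookCount_map]

theorem rookCount_wordBoard_cons_false (w : List Bool) (k : ℕ) :
    rookCount (wordBoard (false :: w)) (k + 1) =
      rookCount (wordBoard w) (k + 1) + rookCount (wordBoard w) k * (w.count true - k) := by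
  rw [wordBoard_cons_false, rookCount_insert_column, rookCount_map, rookCount_map,
    Nat.card_Icc, Nat.add_sub_cancel]
  · intro p hp
    obtain ⟨⟨i, j⟩, h, rfl⟩ := Finset.mem_map.1 hp
    exact Finset.mem_Icc.2 (mem_wordBoard.1 h).2.1
  · intro p hp
    obtain ⟨⟨i, j⟩, h, rfl⟩ := Finset.mem_map.1 hp
    have := (mem_wordBoard.1 h).1.1
    simp only [Function.Embedding.coe_prodMap, Prod.map_apply, addRightEmbedding_apply]
    omega

theorem rookCount_wordBoard_eq_zero {w : List Bool} {k : ℕ}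
    (hk : w.count false < k ∨ w.count true < k) : rookCount (wordBoard w) k = 0 :=
  rookCount_eq_zero (Finset.filter_subset _ _) (by simpa using hk)

theorem xOp_pow_apply (m : ℕ) (p : Polynomial ℝ) : (xOp ^ m) p = Polynomial.X ^ m * p := by
  rw [xOp, LinearMap.pow_mulLeft, LinearMap.mulLeft_apply]

theorem dOp_mul_xOp_pow (m : ℕ) :
    dOp * xOp ^ m = xOp ^ m * dOp + (m : ℝ) • xOp ^ (m - 1) := by
  refine LinearMap.ext fun p => ?_
  simp only [Module.End.mul_apply, LinearMap.add_apply, LinearMap.smul_apply, xOp_pow_apply]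
  simp only [dOp, Polynomial.derivative_mul, Polynomial.derivative_X_pow, Polynomial.smul_eq_C_mul]
  ring

/-- The normal ordering of an arbitrary word. -/
theorem wordOp_eq_sum (w : List Bool) :
    wordOp w = ∑ k ∈ Finset.range (w.count false + 1),
      (rookCount (wordBoard w) k : ℝ) • (xOp ^ (w.count true - k) * dOp ^ (w.count false - k)) := by
  induction w with
  | nil => simp [wordOp, rookCount_zero]; rfl
  | cons b w ih =>
    cases b
    · have hstep : wordOp (false :: w) = dOp * wordOp w := rfl
      rw [hstep, ih, List.count_cons_self, List.count_cons_of_ne (by decide : false ≠ true)]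
      set a := w.count true
      set d := w.count false
      have hlast : (rookCount (wordBoard w) (d + 1) : ℝ) = 0 := by
        rw [rookCount_wordBoard_eq_zero (Or.inl (Nat.lt_succ_self _)), Nat.cast_zero]
      have hx : ∑ k ∈ Finset.range (d + 1), (rookCount (wordBoard w) k : ℝ) •
            (xOp ^ (a - k) * dOp ^ (d + 1 - k)) =
          ∑ k ∈ Finset.range (d + 1), (rookCount (wordBoard w) (k + 1) : ℝ) •
            (xOp ^ (a - (k + 1)) * dOp ^ (d + 1 - (k + 1))) + xOp ^ a * dOp ^ (d + 1) := by
        have h := Finset.sum_range_succ (fun k => (rookCount (wordBoard w) k : ℝ) •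
            (xOp ^ (a - k) * dOp ^ (d + 1 - k))) (d + 1)
        rw [Finset.sum_range_succ', hlast, zero_smul, add_zero, rookCount_zero] at h
        simpa using h.symm
      rw [Finset.sum_range_succ' _ (d + 1), rookCount_zero]
      simp only [rookCount_wordBoard_cons_false, Nat.cast_add, add_smul, Finset.sum_add_distrib]
      rw [Nat.cast_one, one_smul, Nat.sub_zero, Nat.sub_zero, add_right_comm, ← hx,
        ← Finset.sum_add_distrib, Finset.mul_sum]
      refine Finset.sum_congr rfl fun k hk => ?_
      have hkd : d + 1 - k = (d - k) + 1 := by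
        have := Finset.mem_range.1 hk
        omega
      rw [mul_smul_comm, ← mul_assoc, dOp_mul_xOp_pow, add_mul, smul_add, hkd, pow_succ' dOp,
        mul_assoc, Nat.add_sub_add_right, smul_mul_assoc, smul_smul, Nat.cast_mul, Nat.sub_sub]
    · have hstep : wordOp (true :: w) = xOp * wordOp w := rfl
      rw [hstep, ih, List.count_cons_self, List.count_cons_of_ne (by decide : true ≠ false),
        Finset.mul_sum]
      refine Finset.sum_congr rfl fun k _ => ?_
      rw [rookCount_wordBoard_cons_true]
      by_cases hk : w.count true < k
      · rw [rookCount_wordBoard_eq_zero (Or.inr hk)]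
        simp
      · rw [mul_smul_comm, ← mul_assoc, ← pow_succ', Nat.sub_add_comm (not_lt.1 hk)]

/-- The operators `x^k D^k` are linearly independent. -/
theorem eq_zero_of_sum_xOp_pow_mul_dOp_pow_eq_zero {N : ℕ} {c : ℕ → ℝ}
    (h : ∑ k ∈ Finset.range N, c k • (xOp ^ k * dOp ^ k) = 0) :
    ∀ k < N, c k = 0 := by
  intro m
  induction m using Nat.strong_induction_on with
  | _ m ih =>
    intro hm
    have hX := LinearMap.congr_fun h (Polynomial.X ^ m)
    rw [LinearMap.sum_apply, Finset.sum_eq_single m] at hX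
    · have hd : (dOp ^ m) (Polynomial.X ^ m) = Polynomial.C ((m.factorial : ℕ) : ℝ) := by
        rw [Module.End.pow_apply]
        simp only [dOp]
        rw [Polynomial.iterate_derivative_X_pow_eq_C_mul]
        simp [Nat.descFactorial_self]
      rw [LinearMap.smul_apply, Module.End.mul_apply, hd, xOp_pow_apply, LinearMap.zero_apply,
        smul_eq_zero] at hX
      refine hX.resolve_right (mul_ne_zero (pow_ne_zero _ Polynomial.X_ne_zero) ?_)
      exact Polynomial.C_ne_zero.2 (Nat.cast_ne_zero.2 m.factorial_ne_zero)
    · intro k hk hkm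
      rcases lt_or_gt_of_ne hkm with hlt | hgt
      · rw [ih k hlt (Finset.mem_range.1 hk), zero_smul, LinearMap.zero_apply]
      · rw [LinearMap.smul_apply, Module.End.mul_apply, Module.End.pow_apply dOp]
        have : dOp^[k] (Polynomial.X ^ m) = 0 :=
          Polynomial.iterate_derivative_eq_zero (by simpa using hgt)
        rw [this, map_zero, smul_zero]
    · intro hm'
      exact absurd (Finset.mem_range.2 hm) hm'

theorem xkDk_natCast (k : ℕ) : xkDk k = xOp ^ k * dOp ^ k := by
  rw [xkDk, if_pos (Int.natCast_nonneg k), Int.toNat_natCast]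
  rfl

theorem IsNormalOrder.exists_wordOp_eq_sum {w : List Bool} {S : ℤ → ℝ} (hS : IsNormalOrder w S) :
    ∃ N : ℕ, ∀ M, N ≤ M →
      wordOp w = ∑ k ∈ Finset.range M, S k • (xOp ^ k * dOp ^ k) := by
  obtain ⟨hfin, hneg, hw⟩ := hS
  obtain ⟨b, hb⟩ := hfin.bddAbove
  refine ⟨b.toNat + 1, fun M hM => ?_⟩
  rw [hw, finsum_eq_sum_of_support_subset (s := (Finset.range M).map Nat.castEmbedding),
    Finset.sum_map]
  · exact Finset.sum_congr rfl fun k _ => congrArg _ (xkDk_natCast k)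
  · intro k hk
    have hk0 : S k ≠ 0 := fun e => hk (by simp [e])
    have h0 : 0 ≤ k := not_lt.1 fun h => hk0 (hneg k h)
    have hkb : k ≤ b := hb hk0
    rw [Finset.mem_coe, Finset.mem_map]
    exact ⟨k.toNat, Finset.mem_range.2 (by omega), Int.toNat_of_nonneg h0⟩

/-- Navon's theorem: for a Dyck word `w` with `n` `x`'s, the normal order coefficient `S_w(k)`
equals `r_{n-k}(B_w)`, the number of placements of `n - k` non-attacking rooks on the Ferrers
board `B_w`. -/
theorem normalOrder_eq_rookCount (w : List Bool) (hw : IsDyck w) (n : ℕ)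
    (hn : w.count true = n) (S : ℤ → ℝ) (hS : IsNormalOrder w S) (k : ℤ) :
    S k = if 0 ≤ (n : ℤ) - k then (rookCount (ferrersBoard w) ((n : ℤ) - k).toNat : ℝ)
      else 0 := by
  subst hn
  have hboard : ferrersBoard w = wordBoard w := by rw [ferrersBoard, wordBoard, hw.1]
  rw [hboard]
  set n := w.count true with hn
  rcases lt_or_ge k 0 with hk | hk
  · rw [hS.2.1 k hk, if_pos (by omega), rookCount_wordBoard_eq_zero (Or.inr (by omega)),
      Nat.cast_zero]
  lift k to ℕ using hk
  obtain ⟨N, hN⟩ := hS.exists_wordOp_eq_sum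
  set T : ℕ → ℝ := fun k => if k ≤ n then (rookCount (wordBoard w) (n - k) : ℝ) else 0 with hT
  have hsum : wordOp w =
      ∑ k ∈ Finset.range (N + n + 1 + k), T k • (xOp ^ k * dOp ^ k) := by
    rw [← Finset.sum_subset (Finset.range_mono (by omega : n + 1 ≤ N + n + 1 + k)),
      wordOp_eq_sum, ← hw.1, ← hn, ← Finset.sum_range_reflect]
    · refine Finset.sum_congr rfl fun j hj => ?_
      have hj : j ≤ n := Nat.lt_succ_iff.1 (Finset.mem_range.1 hj)
      rw [hT]
      simp only [if_pos hj, Nat.add_sub_cancel, Nat.sub_sub_self hj]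
    · intro j _ hj
      rw [hT]
      simp only [if_neg (fun h => hj (Finset.mem_range.2 (Nat.lt_succ_iff.2 h))), zero_smul]
  have hdiff : ∑ j ∈ Finset.range (N + n + 1 + k),
      (S j - T j) • (xOp ^ j * dOp ^ j) = 0 := by
    rw [Finset.sum_congr rfl fun (j : ℕ) _ => sub_smul (S j) (T j) (xOp ^ j * dOp ^ j),
      Finset.sum_sub_distrib, ← hsum, ← hN _ (by omega), sub_self]
  have hST : S k = T k := sub_eq_zero.1
    (eq_zero_of_sum_xOp_pow_mul_dOp_pow_eq_zero (c := fun j => S j - T j) hdiff k (by omega))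
  rw [hST, hT]
  by_cases hkn : k ≤ n
  · simp only [if_pos hkn, if_pos (by omega : (0 : ℤ) ≤ n - k)]
    congr 2
    omega
  · simp only [if_neg hkn, if_neg (by omega : ¬ (0 : ℤ) ≤ n - k)]
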